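/- For 4/3 < p < 4 and for any (z₁,z₂), (ξ₁,ξ₂) ∈ ℋ with test function f_{(ξ₁,ξ₂)}(w₁,w₂) = (1-ξ₂·conj(w₂))^{1-2/p}/(w₂(1-w₂·conj(ξ₂))) · (1-(ξ₁/ξ₂)(conj(w₁)/conj(w₂)))^{1-2/p}/(1-(w₁/w₂)(conj(ξ₁)/conj(ξ₂))), the Bergman projection satisfies P f_{(ξ₁,ξ₂)}(z₁,z₂) = (1/z₂)·[∑_{k≥0} ((1)_k/k!) F(2/p-1, 1+k; 2+k; |ξ₂|²)(z₂·conj(ξ₂))^k] · [∑_{l≥0} ((1)_l/l!) F(2/p-1, 1+l; 2+l; |ξ₁/ξ₂|²)((z₁/z₂)·(conj(ξ₁)/conj(ξ₂)))^l]. -/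

import Mathlib

open MeasureTheory Real Set ComplexConjugate

/-- Pochhammer symbol `(a)_n` for a real number `a`. -/
noncomputable def poch (a : ℝ) (n : ℕ) : ℝ := ∏ i ∈ Finset.range n, (a + i)

/-- Gauss hypergeometric series `F(a,b;c;x)`. -/
noncomputable def hypF (a b c x : ℝ) : ℝ :=
  ∑' n : ℕ, poch a n * poch b n / (poch c n * n.factorial) * x ^ n

/-- The Hartogs triangle. -/
def Hartogs : Set (ℂ × ℂ) := {z | ‖z.1‖ < ‖z.2‖ ∧ ‖z.2‖ < 1}

/-- The measure `μ = dV/π²` on the Hartogs triangle. -/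
noncomputable def muH : Measure (ℂ × ℂ) :=
  (ENNReal.ofReal (π ^ 2))⁻¹ • (volume.restrict Hartogs)

/-- The Bergman kernel of the Hartogs triangle. -/
noncomputable def bergmanKernel (z w : ℂ × ℂ) : ℂ :=
  z.2 * conj w.2 / ((1 - z.2 * conj w.2) ^ 2 * (z.2 * conj w.2 - z.1 * conj w.1) ^ 2)

/-- The Bergman projection of the Hartogs triangle, as an integral operator. -/
noncomputable def bergmanProj (f : ℂ × ℂ → ℂ) (z : ℂ × ℂ) : ℂ :=
  ∫ w, bergmanKernel z w * f w ∂muH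

/-- The test function `f_{(ξ₁,ξ₂)}`. -/
noncomputable def testF (p : ℝ) (ξ w : ℂ × ℂ) : ℂ :=
  (1 - ξ.2 * conj w.2) ^ (((1 - 2 / p : ℝ) : ℂ)) / (w.2 * (1 - w.2 * conj ξ.2)) *
    ((1 - ξ.1 / ξ.2 * (conj w.1 / conj w.2)) ^ (((1 - 2 / p : ℝ) : ℂ)) /
      (1 - w.1 / w.2 * (conj ξ.1 / conj ξ.2)))


theorem map_div_const_volume {c : ℂ} (hc : c ≠ 0) :
    Measure.map (fun w : ℂ ↦ w / c) volume = ENNReal.ofReal (‖c‖ ^ 2) • volume := by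
  have hdet : LinearMap.det (Algebra.lmul ℝ ℂ c⁻¹) = (‖c‖ ^ 2)⁻¹ := by
    rw [← Algebra.norm_apply, Algebra.norm_complex_apply, map_inv₀, Complex.normSq_eq_norm_sq]
  have h := Measure.map_linearMap_addHaar_eq_smul_addHaar (volume : Measure ℂ)
    (f := Algebra.lmul ℝ ℂ c⁻¹) (by rw [hdet]; positivity)
  rw [hdet, inv_inv, abs_of_nonneg (by positivity)] at h
  rw [← h]
  congr 1
  ext w
  simp [div_eq_inv_mul]

theorem measurableEmbedding_div_const {c : ℂ} (hc : c ≠ 0) :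
    MeasurableEmbedding fun w : ℂ ↦ w / c := by
  simpa [div_eq_mul_inv] using measurableEmbedding_mulRight₀ (inv_ne_zero hc)

theorem integral_comp_div_const {c : ℂ} (hc : c ≠ 0) {E : Type*} [NormedAddCommGroup E]
    [NormedSpace ℝ E] (g : ℂ → E) : ∫ w, g (w / c) = ‖c‖ ^ 2 • ∫ w, g w := by
  rw [← (measurableEmbedding_div_const hc).integral_map, map_div_const_volume hc,
    integral_smul_measure, ENNReal.toReal_ofReal (by positivity)]

theorem integrable_comp_div_const {c : ℂ} (hc : c ≠ 0) {g : ℂ → ℂ} (hg : Integrable g) :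
    Integrable fun w ↦ g (w / c) := by
  refine (((measurableEmbedding_div_const hc).integrable_map_iff (g := g)).mp ?_)
  rw [map_div_const_volume hc]
  exact hg.smul_measure ENNReal.ofReal_ne_top

theorem integrable_twisted_prod {g h : ℂ → ℂ} (hg : Integrable g) (hh : Integrable h)
    (hgm : Measurable g) (hhm : Measurable h) :
    Integrable fun w : ℂ × ℂ ↦ (‖w.2‖ ^ 2)⁻¹ • (h w.2 * g (w.1 / w.2)) := by
  rw [Measure.volume_eq_prod, integrable_prod_iff' (by
    apply Measurable.aestronglyMeasurable; fun_prop)]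
  have h0 : ∀ᵐ c : ℂ, c ≠ 0 := by simp [ae_iff]
  constructor
  · filter_upwards [h0] with c hc
    exact ((integrable_comp_div_const hc hg).const_mul (h c)).smul (‖c‖ ^ 2)⁻¹
  · refine (hh.norm.mul_const (∫ w, ‖g w‖)).congr ?_
    filter_upwards [h0] with c hc
    simp only [norm_smul, norm_mul, integral_const_mul]
    rw [integral_comp_div_const hc fun w ↦ ‖g w‖]
    have : ‖c‖ ≠ 0 := by simpa
    simp
    field_simp

theorem integral_twisted_prod {g h : ℂ → ℂ} (hg : Integrable g) (hh : Integrable h)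
    (hgm : Measurable g) (hhm : Measurable h) :
    ∫ w : ℂ × ℂ, (‖w.2‖ ^ 2)⁻¹ • (h w.2 * g (w.1 / w.2)) = (∫ w, h w) * ∫ w, g w := by
  have hint := integrable_twisted_prod hg hh hgm hhm
  rw [Measure.volume_eq_prod] at hint ⊢
  rw [integral_prod_symm _ hint, ← integral_mul_const]
  apply integral_congr_ae
  have h0 : ∀ᵐ c : ℂ, c ≠ 0 := by simp [ae_iff]
  filter_upwards [h0] with c hc
  simp only [integral_smul, integral_const_mul]
  rw [integral_comp_div_const hc g]
  have : (‖c‖ : ℂ) ≠ 0 := by simpa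
  simp
  field_simp

theorem integral_ball_pow_mul_conj_pow (k n : ℕ) :
    ∫ w in Metric.ball (0 : ℂ) 1, w ^ k * conj w ^ n = if k = n then (π / (k + 1) : ℂ) else 0 := by
  rw [← integral_indicator measurableSet_ball, ← Complex.integral_comp_polarCoord_symm]
  have : ∀ q ∈ polarCoord.target,
      q.1 • (Metric.ball (0 : ℂ) 1).indicator (fun w ↦ w ^ k * conj w ^ n)
        (Complex.polarCoord.symm q) =
      (Set.Ioo 0 1).indicator (fun r : ℝ ↦ (r : ℂ) ^ (k + n + 1)) q.1 *
       Complex.exp ((k - n : ℤ) * q.2 * Complex.I) := by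
    rintro ⟨r, θ⟩ ⟨hr, hθ⟩
    simp only [Set.mem_Ioi] at hr
    have hs : Complex.polarCoord.symm (r, θ) = r * Complex.exp (θ * Complex.I) := by
      rw [Complex.polarCoord_symm_apply, Complex.exp_mul_I]; push_cast; rfl
    rw [hs]
    by_cases h1 : r < 1
    · rw [Set.indicator_of_mem, Set.indicator_of_mem]
      · simp only [mul_pow, map_mul, ← Complex.exp_conj, Complex.conj_ofReal, Complex.conj_I,
          ← Complex.exp_nat_mul]
        rw [show (r : ℂ) ^ k * Complex.exp (k * (θ * Complex.I)) *
          (r ^ n * Complex.exp (n * (θ * -Complex.I))) = r ^ (k + n) *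
          (Complex.exp (k * (θ * Complex.I)) * Complex.exp (n * (θ * -Complex.I))) by ring,
          ← Complex.exp_add, Complex.real_smul, ← mul_assoc, ← pow_succ']
        congr 2
        push_cast; ring
      · exact ⟨hr, h1⟩
      · simpa [Complex.norm_exp_ofReal_mul_I, abs_of_pos hr] using h1
    · rw [Set.indicator_of_notMem, Set.indicator_of_notMem]
      · simp
      · exact fun h ↦ h1 h.2
      · simpa [Complex.norm_exp_ofReal_mul_I, abs_of_pos hr] using h1
  rw [setIntegral_congr_fun polarCoord.open_target.measurableSet this, polarCoord_target,
    Measure.volume_eq_prod, setIntegral_prod_mul (fun r : ℝ ↦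
    (Set.Ioo 0 1).indicator (fun r : ℝ ↦ (r : ℂ) ^ (k + n + 1)) r)
    (fun θ : ℝ ↦ Complex.exp ((k - n : ℤ) * θ * Complex.I)),
    setIntegral_indicator measurableSet_Ioo, Set.inter_eq_right.mpr Set.Ioo_subset_Ioi_self,
    ← integral_Ioc_eq_integral_Ioo, ← integral_Ioc_eq_integral_Ioo,
    ← intervalIntegral.integral_of_le zero_le_one,
    ← intervalIntegral.integral_of_le (by linarith [pi_pos])]
  have hr : ∫ r : ℝ in (0 : ℝ)..1, (r : ℂ) ^ (k + n + 1) = 1 / (k + n + 2) := by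
    have := integral_pow (a := 0) (b := 1) (k + n + 1)
    have h2 := congrArg (fun x : ℝ ↦ (x : ℂ)) this
    simp only [← intervalIntegral.integral_ofReal] at h2
    push_cast at h2
    rw [h2]
    simp
    ring
  rw [hr]
  split_ifs with h
  · subst h
    have : (k : ℂ) + 1 ≠ 0 := by exact_mod_cast k.succ_ne_zero
    rw [show (k : ℂ) + k + 2 = 2 * (k + 1) by ring]
    simp
    field_simp
    ring
  · have hm : ((k - n : ℤ) : ℂ) ≠ 0 := by
      exact_mod_cast (show (k : ℤ) - n ≠ 0 by omega)
    have : ∀ θ : ℝ, Complex.exp ((k - n : ℤ) * θ * Complex.I) =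
        Complex.exp (((k - n : ℤ) * Complex.I) * θ) := fun θ ↦ by congr 1; ring
    simp only [this]
    rw [integral_exp_mul_complex (by simpa using hm)]
    have : Complex.exp (((k - n : ℤ) * Complex.I) * π) =
        Complex.exp (((k - n : ℤ) * Complex.I) * (-π : ℝ)) := by
      rw [Complex.exp_eq_exp_iff_exists_int]
      exact ⟨k - n, by push_cast; ring⟩
    rw [this]
    simp

theorem poch_eq_ascPochhammer (a : ℝ) (n : ℕ) : poch a n = (ascPochhammer ℝ n).eval a := by
  induction n with
  | zero => simp [poch]
  | succ n ih => rw [poch, Finset.prod_range_succ, ← poch, ih, ascPochhammer_succ_eval]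

theorem choose_eq_poch_div (a : ℝ) (n : ℕ) :
    Ring.choose ((a : ℂ) + n - 1) n = ((poch a n / n.factorial : ℝ) : ℂ) := by
  rw [← Ring.multichoose_eq]
  have h := Ring.factorial_nsmul_multichoose_eq_ascPochhammer a n
  rw [Polynomial.ascPochhammer_smeval_eq_eval, ← poch_eq_ascPochhammer] at h
  have h2 := Ring.map_multichoose (algebraMap ℝ ℂ) a n
  simp only [Complex.coe_algebraMap] at h2
  rw [← h2, ← h]
  have : (n.factorial : ℝ) ≠ 0 := by positivity
  rw [nsmul_eq_mul, mul_div_cancel_left₀ _ this]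

theorem poch_one_add_div_poch (m n : ℕ) :
    poch (1 + m) n / poch (2 + m) n = (m + 1) / (m + n + 1) := by
  have hpos : poch (2 + m) n ≠ 0 := Finset.prod_ne_zero_iff.mpr fun i _ ↦ by positivity
  have h : poch (1 + m) n * (m + n + 1) = (m + 1) * poch (2 + m) n := by
    induction n with
    | zero => simp [poch]
    | succ n ih =>
      have ih := ih (Finset.prod_ne_zero_iff.mpr fun i _ ↦ by positivity)
      simp only [poch, Finset.prod_range_succ] at ih ⊢
      push_cast
      linear_combination (2 + (m : ℝ) + n) * ih
  rw [div_eq_div_iff hpos (by positivity), h]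

theorem hypF_one_add_two_add (a x : ℝ) (m : ℕ) :
    hypF a (1 + m) (2 + m) x =
      ∑' n : ℕ, poch a n / n.factorial * ((m + 1) / (m + n + 1)) * x ^ n := by
  refine tsum_congr fun n ↦ ?_
  rw [← poch_one_add_div_poch]
  ring

theorem poch_one (n : ℕ) : poch 1 n = n.factorial := by
  rw [poch_eq_ascPochhammer, ascPochhammer_eval_one]

theorem hasSum_poch (a : ℝ) {x : ℂ} (hx : ‖x‖ < 1) :
    HasSum (fun n : ℕ ↦ ((poch a n / n.factorial : ℝ) : ℂ) * x ^ n) (1 / (1 - x) ^ (a : ℂ)) := by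
  have h := (Complex.one_div_one_sub_cpow_hasFPowerSeriesOnBall_zero a).hasSum (y := x)
    (by rw [← ENNReal.ofReal_one, Metric.eball_ofReal]; simpa using hx)
  simpa [FormalMultilinearSeries.ofScalars, choose_eq_poch_div] using h

theorem summable_norm_poch (a : ℝ) {x : ℂ} (hx : ‖x‖ < 1) :
    Summable fun n : ℕ ↦ ‖((poch a n / n.factorial : ℝ) : ℂ) * x ^ n‖ :=
  (hasSum_poch a hx).summable.norm

theorem hasSum_succ_mul_pow {x : ℂ} (hx : ‖x‖ < 1) :
    HasSum (fun n : ℕ ↦ ((n : ℂ) + 1) * x ^ n) (1 / (1 - x) ^ 2) := by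
  simpa using hasSum_choose_mul_geometric_of_norm_lt_one 1 hx

/-- The integrand of the one-variable disc integrals into which the projection factors. -/
noncomputable def diskIntegrand (a : ℝ) (z ξ w : ℂ) : ℂ :=
  1 / (1 - z * conj w) ^ 2 * (1 / (1 - ξ * conj w) ^ (a : ℂ) * (1 - conj ξ * w)⁻¹)

theorem measurable_diskIntegrand (a : ℝ) (z ξ : ℂ) : Measurable (diskIntegrand a z ξ) := by
  have : Measurable fun w : ℂ ↦ conj w := Complex.continuous_conj.measurable
  unfold diskIntegrand
  fun_prop

theorem norm_mul_lt_one {z w : ℂ} (hz : ‖z‖ < 1) (hw : ‖w‖ ≤ 1) : ‖z * w‖ < 1 := by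
  rw [norm_mul]
  exact (mul_le_of_le_one_right (norm_nonneg _) hw).trans_lt hz

theorem integrableOn_diskIntegrand (a : ℝ) {z ξ : ℂ} (hz : ‖z‖ < 1) (hξ : ‖ξ‖ < 1) :
    IntegrableOn (diskIntegrand a z ξ) (Metric.ball 0 1) := by
  refine (ContinuousOn.integrableOn_compact (isCompact_closedBall (0 : ℂ) 1) ?_).mono_set
    Metric.ball_subset_closedBall
  have hne : ∀ {c : ℂ} {w : ℂ}, ‖c‖ < 1 → ‖w‖ ≤ 1 → 1 - c * w ≠ 0 := by
    intro c w hc hw h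
    have := norm_mul_lt_one hc hw
    rw [← sub_eq_zero.mp h] at this
    simp at this
  have hconj : Continuous fun w : ℂ ↦ conj w := Complex.continuous_conj
  have hslit : ∀ w ∈ Metric.closedBall (0 : ℂ) 1, 1 - ξ * conj w ∈ Complex.slitPlane := by
    intro w hw
    rw [sub_eq_add_neg]
    apply Complex.mem_slitPlane_of_norm_lt_one
    rw [norm_neg]
    exact norm_mul_lt_one hξ (by simpa using hw)
  unfold diskIntegrand
  refine .mul (.div continuousOn_const (by fun_prop) fun w hw ↦ ?_)
    (.mul (.div continuousOn_const (.cpow (by fun_prop) continuousOn_const hslit) fun w hw ↦ ?_)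
      (.inv₀ (by fun_prop) fun w hw ↦ ?_))
  · exact pow_ne_zero 2 (hne hz (by simpa using hw))
  · simp [Complex.cpow_eq_zero_iff, Complex.slitPlane_ne_zero (hslit w hw)]
  · exact hne (by simpa using hξ) (by simpa using hw)

/-- The coefficient of `w ^ k * conj w ^ (m + j)`, for the index `(m, j, k)`, in the expansion of
`diskIntegrand a z ξ w`. -/
noncomputable def diskCoeff (a : ℝ) (z ξ : ℂ) (i : ℕ × ℕ × ℕ) : ℂ :=
  ((i.1 + 1) * z ^ i.1) *
    ((((poch a i.2.1 / i.2.1.factorial : ℝ) : ℂ) * ξ ^ i.2.1) * conj ξ ^ i.2.2)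

theorem summable_norm_mul_mul {f g h : ℕ → ℂ} (hf : Summable fun n ↦ ‖f n‖)
    (hg : Summable fun n ↦ ‖g n‖) (hh : Summable fun n ↦ ‖h n‖) :
    Summable fun i : ℕ × ℕ × ℕ ↦ ‖f i.1 * (g i.2.1 * h i.2.2)‖ := by
  have h1 : Summable fun q : ℕ × ℕ ↦ ‖g q.1 * h q.2‖ := hg.mul_norm hh
  have h2 := hf.mul_norm h1
  exact h2

theorem hasSum_mul_mul {f g h : ℕ → ℂ} {s t u : ℂ} (hf : HasSum f s)
    (hg : HasSum g t) (hh : HasSum h u) :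
    HasSum (fun i : ℕ × ℕ × ℕ ↦ f i.1 * (g i.2.1 * h i.2.2)) (s * (t * u)) := by
  have h1 : HasSum (fun q : ℕ × ℕ ↦ g q.1 * h q.2) (t * u) :=
    hg.mul hh (summable_mul_of_summable_norm hg.summable.norm hh.summable.norm)
  have h2 := hf.mul h1
    (summable_norm_mul_mul hf.summable.norm hg.summable.norm hh.summable.norm).of_norm
  exact h2

theorem summable_norm_diskCoeff (a : ℝ) {z ξ : ℂ} (hz : ‖z‖ < 1) (hξ : ‖ξ‖ < 1) :
    Summable fun i ↦ ‖diskCoeff a z ξ i‖ := by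
  have h3 : Summable fun n ↦ ‖conj ξ ^ n‖ :=
    (hasSum_geometric_of_norm_lt_one (ξ := conj ξ) (by simpa using hξ)).summable.norm
  have h := summable_norm_mul_mul (hasSum_succ_mul_pow hz).summable.norm
    (summable_norm_poch a hξ) h3
  exact h

theorem hasSum_diskIntegrand (a : ℝ) {z ξ w : ℂ} (hz : ‖z‖ < 1) (hξ : ‖ξ‖ < 1) (hw : ‖w‖ ≤ 1) :
    HasSum (fun i ↦ diskCoeff a z ξ i * (w ^ i.2.2 * conj w ^ (i.1 + i.2.1)))
      (diskIntegrand a z ξ w) := by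
  have hξ' : ‖conj ξ‖ < 1 := by simpa using hξ
  have hw' : ‖conj w‖ ≤ 1 := by simpa using hw
  have h := hasSum_mul_mul (hasSum_succ_mul_pow (norm_mul_lt_one hz hw'))
    (hasSum_poch a (norm_mul_lt_one hξ hw'))
    (hasSum_geometric_of_norm_lt_one (norm_mul_lt_one hξ' hw))
  rw [diskIntegrand]
  convert h using 2 with i
  rw [diskCoeff, mul_pow, mul_pow, mul_pow, pow_add]
  ring

theorem hasSum_integral_diskIntegrand (a : ℝ) {z ξ : ℂ} (hz : ‖z‖ < 1) (hξ : ‖ξ‖ < 1) :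
    HasSum (fun q : ℕ × ℕ ↦ diskCoeff a z ξ (q.1, q.2, q.1 + q.2) * (π / (q.1 + q.2 + 1)))
      (∫ w in Metric.ball 0 1, diskIntegrand a z ξ w) := by
  have hconj : Continuous fun w : ℂ ↦ conj w := Complex.continuous_conj
  have hint : ∀ i : ℕ × ℕ × ℕ, IntegrableOn
      (fun w ↦ diskCoeff a z ξ i * (w ^ i.2.2 * conj w ^ (i.1 + i.2.1))) (Metric.ball 0 1) := by
    intro i
    refine (ContinuousOn.integrableOn_compact (isCompact_closedBall (0 : ℂ) 1) ?_).mono_set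
      Metric.ball_subset_closedBall
    fun_prop
  have hle : ∀ i : ℕ × ℕ × ℕ, ∀ w ∈ Metric.ball (0 : ℂ) 1,
      ‖diskCoeff a z ξ i * (w ^ i.2.2 * conj w ^ (i.1 + i.2.1))‖ ≤ ‖diskCoeff a z ξ i‖ := by
    intro i w hw
    have hw1 : ‖w‖ ≤ 1 := by simpa using (Metric.mem_ball.mp hw).le
    rw [norm_mul]
    refine mul_le_of_le_one_right (norm_nonneg _) ?_
    rw [norm_mul, norm_pow, norm_pow, RCLike.norm_conj]
    exact mul_le_one₀ (pow_le_one₀ (norm_nonneg _) hw1) (by positivity)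
      (pow_le_one₀ (norm_nonneg _) hw1)
  have hsum : Summable fun i : ℕ × ℕ × ℕ ↦ ∫ w in Metric.ball 0 1,
      ‖diskCoeff a z ξ i * (w ^ i.2.2 * conj w ^ (i.1 + i.2.1))‖ := by
    refine ((summable_norm_diskCoeff a hz hξ).mul_right
      (volume.real (Metric.ball (0 : ℂ) 1))).of_nonneg_of_le
      (fun i ↦ integral_nonneg fun w ↦ norm_nonneg _) fun i ↦ ?_
    have h := norm_setIntegral_le_of_norm_le_const (μ := volume) (C := ‖diskCoeff a z ξ i‖)
      (f := fun w ↦ ‖diskCoeff a z ξ i * (w ^ i.2.2 * conj w ^ (i.1 + i.2.1))‖)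
      (measure_ball_lt_top (x := (0 : ℂ)) (r := 1)) (by simpa only [norm_norm] using hle i)
    exact (le_abs_self _).trans h
  have key := hasSum_integral_of_summable_integral_norm hint hsum
  have hpt : ∀ w ∈ Metric.ball (0 : ℂ) 1,
      ∑' i : ℕ × ℕ × ℕ, diskCoeff a z ξ i * (w ^ i.2.2 * conj w ^ (i.1 + i.2.1)) =
        diskIntegrand a z ξ w := fun w hw ↦
    (hasSum_diskIntegrand a hz hξ (by simpa using (Metric.mem_ball.mp hw).le)).tsum_eq
  rw [setIntegral_congr_fun measurableSet_ball hpt] at key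
  simp only [integral_const_mul, integral_ball_pow_mul_conj_pow] at key
  have hinj : Function.Injective fun q : ℕ × ℕ ↦ (q.1, q.2, q.1 + q.2) := fun q r h ↦ by
    simp only [Prod.mk.injEq] at h
    exact Prod.ext h.1 h.2.1
  rw [← hinj.hasSum_iff] at key
  · simpa [Function.comp_def] using key
  · rintro ⟨m, j, k⟩ h
    rw [if_neg, mul_zero]
    intro hk
    exact h ⟨(m, j), by simpa using hk.symm⟩

theorem integral_diskIntegrand (a : ℝ) {z ξ : ℂ} (hz : ‖z‖ < 1) (hξ : ‖ξ‖ < 1) :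
    ∫ w in Metric.ball 0 1, diskIntegrand a z ξ w =
      π * ∑' m : ℕ, ((poch 1 m / m.factorial * hypF a (1 + m) (2 + m) (‖ξ‖ ^ 2) : ℝ) : ℂ) *
        (z * conj ξ) ^ m := by
  have key := hasSum_integral_diskIntegrand a hz hξ
  have hnorm : ((‖ξ‖ ^ 2 : ℝ) : ℂ) = ξ * conj ξ := by
    rw [Complex.mul_conj, Complex.normSq_eq_norm_sq]
  rw [← key.tsum_eq, key.summable.tsum_prod, ← tsum_mul_left]
  refine tsum_congr fun m ↦ ?_
  rw [poch_one, div_self (by positivity), one_mul, hypF_one_add_two_add, Complex.ofReal_tsum,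
    mul_comm _ ((z * conj ξ) ^ m), ← mul_assoc, ← tsum_mul_left]
  refine tsum_congr fun j ↦ ?_
  simp only [diskCoeff]
  rw [Complex.ofReal_mul _ ((‖ξ‖ ^ 2) ^ j), Complex.ofReal_pow _ j, hnorm, mul_pow, mul_pow,
    pow_add]
  push_cast
  ring

theorem measurableSet_Hartogs : MeasurableSet Hartogs :=
  (measurableSet_lt measurable_fst.norm measurable_snd.norm).inter
    (measurableSet_lt measurable_snd.norm measurable_const)

theorem bergmanKernel_mul_testF (p : ℝ) {z ξ w : ℂ × ℂ} (hz : z.2 ≠ 0) (hw : w.2 ≠ 0) :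
    bergmanKernel z w * testF p ξ w = 1 / z.2 * ((‖w.2‖ ^ 2)⁻¹ •
      (diskIntegrand (2 / p - 1) z.2 ξ.2 w.2 *
        diskIntegrand (2 / p - 1) (z.1 / z.2) (ξ.1 / ξ.2) (w.1 / w.2))) := by
  have hcw : conj w.2 ≠ 0 := by simpa using hw
  have hnorm : ((‖w.2‖ ^ 2 : ℝ) : ℂ) = w.2 * conj w.2 := by
    rw [Complex.mul_conj, Complex.normSq_eq_norm_sq]
  have hexp : (((1 - 2 / p : ℝ) : ℂ)) = -((2 / p - 1 : ℝ) : ℂ) := by push_cast; ring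
  have hker : z.2 * conj w.2 - z.1 * conj w.1 =
      z.2 * conj w.2 * (1 - z.1 / z.2 * (conj w.1 / conj w.2)) := by
    field_simp
  rw [Complex.real_smul, Complex.ofReal_inv, hnorm, bergmanKernel, testF, hker, hexp,
    Complex.cpow_neg, Complex.cpow_neg, diskIntegrand, diskIntegrand, map_div₀, map_div₀,
    mul_comm w.2 (conj ξ.2), mul_comm (w.1 / w.2) (conj ξ.1 / conj ξ.2)]
  simp only [mul_pow, div_eq_mul_inv, mul_inv, one_mul]
  field_simp

theorem indicator_Hartogs_div (g h : ℂ → ℂ) (w : ℂ × ℂ) :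
    Hartogs.indicator (fun w ↦ (‖w.2‖ ^ 2)⁻¹ • (h w.2 * g (w.1 / w.2))) w =
      (‖w.2‖ ^ 2)⁻¹ • ((Metric.ball 0 1).indicator h w.2 *
        (Metric.ball 0 1).indicator g (w.1 / w.2)) := by
  classical
  by_cases h0 : w.2 = 0
  · simp [h0, Set.indicator_apply]
  have h1 : w ∈ Hartogs ↔ w.2 ∈ Metric.ball (0 : ℂ) 1 ∧ w.1 / w.2 ∈ Metric.ball (0 : ℂ) 1 := by
    simp [Hartogs, div_lt_one (norm_pos_iff.mpr h0), and_comm]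
  by_cases h2 : w.2 ∈ Metric.ball (0 : ℂ) 1 <;>
  by_cases h3 : w.1 / w.2 ∈ Metric.ball (0 : ℂ) 1 <;>
  simp only [Set.indicator_apply, h1, h2, h3, and_true, and_false, if_true, if_false,
    mul_zero, zero_mul, smul_zero]

theorem setIntegral_Hartogs {g h : ℂ → ℂ} (hg : IntegrableOn g (Metric.ball 0 1))
    (hh : IntegrableOn h (Metric.ball 0 1)) (hgm : Measurable g) (hhm : Measurable h) :
    ∫ w in Hartogs, (‖w.2‖ ^ 2)⁻¹ • (h w.2 * g (w.1 / w.2)) =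
      (∫ w in Metric.ball 0 1, h w) * ∫ w in Metric.ball 0 1, g w := by
  rw [← integral_indicator measurableSet_Hartogs]
  simp only [indicator_Hartogs_div]
  rw [integral_twisted_prod (hg.integrable_indicator measurableSet_ball)
    (hh.integrable_indicator measurableSet_ball) (hgm.indicator measurableSet_ball)
    (hhm.indicator measurableSet_ball), integral_indicator measurableSet_ball,
    integral_indicator measurableSet_ball]

/-- Hypergeometric series expansion of the Bergman projection of the test
function `f_{(ξ₁,ξ₂)}`. -/
theorem bergmanProj_testF (p : ℝ) (hp1 : 4 / 3 < p) (hp2 : p < 4)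
    (z ξ : ℂ × ℂ) (hz : z ∈ Hartogs) (hξ : ξ ∈ Hartogs) :
    bergmanProj (testF p ξ) z =
      (1 / z.2) *
        (∑' k : ℕ,
          ((poch 1 k / k.factorial *
              hypF (2 / p - 1) (1 + k) (2 + k) (‖ξ.2‖ ^ 2) : ℝ) : ℂ) *
            (z.2 * conj ξ.2) ^ k) *
        (∑' l : ℕ,
          ((poch 1 l / l.factorial *
              hypF (2 / p - 1) (1 + l) (2 + l) (‖ξ.1 / ξ.2‖ ^ 2) : ℝ) : ℂ) *
            (z.1 / z.2 * (conj ξ.1 / conj ξ.2)) ^ l) := by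
  have hz0 : 0 < ‖z.2‖ := (norm_nonneg _).trans_lt hz.1
  have hξ0 : 0 < ‖ξ.2‖ := (norm_nonneg _).trans_lt hξ.1
  have hzq : ‖z.1 / z.2‖ < 1 := by rw [norm_div, div_lt_one hz0]; exact hz.1
  have hξq : ‖ξ.1 / ξ.2‖ < 1 := by rw [norm_div, div_lt_one hξ0]; exact hξ.1
  have hEq : ∀ w ∈ Hartogs, bergmanKernel z w * testF p ξ w = 1 / z.2 * ((‖w.2‖ ^ 2)⁻¹ •
      (diskIntegrand (2 / p - 1) z.2 ξ.2 w.2 *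
        diskIntegrand (2 / p - 1) (z.1 / z.2) (ξ.1 / ξ.2) (w.1 / w.2))) := fun w hw ↦
    bergmanKernel_mul_testF p (norm_pos_iff.mp hz0)
      (norm_pos_iff.mp ((norm_nonneg _).trans_lt hw.1))
  have hπ : (π : ℂ) ≠ 0 := by exact_mod_cast pi_ne_zero
  rw [bergmanProj, muH, integral_smul_measure, setIntegral_congr_fun measurableSet_Hartogs hEq,
    integral_const_mul, setIntegral_Hartogs (integrableOn_diskIntegrand _ hzq hξq)
      (integrableOn_diskIntegrand _ hz.2 hξ.2) (measurable_diskIntegrand _ _ _)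
      (measurable_diskIntegrand _ _ _), integral_diskIntegrand _ hz.2 hξ.2,
    integral_diskIntegrand _ hzq hξq, map_div₀, ENNReal.toReal_inv,
    ENNReal.toReal_ofReal (by positivity), Complex.real_smul]
  push_cast
  field_simp
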